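/- For every choice of signs ε_{i,s} ∈ {1, −1} (i ∈ {1,2}, s ∈ {1,2,3}), the assignment k_i(x_s) = ε_{i,s}x_s and e_i(x_s) = f_i(x_s) = 0 for all i, s, extended by the module-algebra conditions, defines a module-algebra structure of U_q(sl(3)) on the quantum 3-space A_q(3). Moreover, two such structures given by sign choices (ε_{i,s}) and (ε'_{i,s}) are isomorphic if and only if ε_{i,s} = ε'_{i,s} for all i, s. -/

import Mathlib

noncomputable section

open scoped BigOperators

/-- The defining relations of the quantum `n`-space `A_q(n)`:
`x_i x_j = q • (x_j x_i)` for `i > j`. -/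
inductive QRel (q : ℂ) (n : ℕ) : FreeAlgebra ℂ (Fin n) → FreeAlgebra ℂ (Fin n) → Prop
  | rel (i j : Fin n) (h : j < i) :
      QRel q n (FreeAlgebra.ι ℂ i * FreeAlgebra.ι ℂ j)
        (q • (FreeAlgebra.ι ℂ j * FreeAlgebra.ι ℂ i))

/-- The quantum `n`-space `A_q(n)`. -/
abbrev QSpace (q : ℂ) (n : ℕ) : Type := RingQuot (QRel q n)

/-- The generator `x_i` of the quantum `n`-space. -/
def Xg (q : ℂ) (n : ℕ) (i : Fin n) : QSpace q n :=
  RingQuot.mkAlgHom ℂ (QRel q n) (FreeAlgebra.ι ℂ i)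

/-- The Cartan matrix of `sl(m+1)`: `a_{ii} = 2`, `a_{ij} = -1` if `|i-j| = 1`,
`a_{ij} = 0` if `|i-j| > 1`. -/
def cartan (m : ℕ) (i j : Fin m) : ℤ :=
  if i = j then 2 else if ((i : ℤ) - (j : ℤ)).natAbs = 1 then -1 else 0

/-- A module-algebra structure of `U_q(sl(m+1))` on a unital `ℂ`-algebra `A`:
`ℂ`-linear maps `k_i` (unital algebra automorphisms with two-sided inverses `(k i).symm`),
`e_i`, `f_i` for `1 ≤ i ≤ m`, satisfying the twisted Leibniz rules and the defining
operator relations of `U_q(sl(m+1))`. -/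
structure UqslMA (q : ℂ) (m : ℕ) (A : Type) [Ring A] [Algebra ℂ A] where
  k : Fin m → (A ≃ₐ[ℂ] A)
  e : Fin m → (A →ₗ[ℂ] A)
  f : Fin m → (A →ₗ[ℂ] A)
  e_mul : ∀ (i : Fin m) (a b : A), e i (a * b) = a * e i b + e i a * k i b
  f_mul : ∀ (i : Fin m) (a b : A), f i (a * b) = (k i).symm a * f i b + f i a * b
  e_one : ∀ i : Fin m, e i 1 = 0
  f_one : ∀ i : Fin m, f i 1 = 0
  k_comm : ∀ (i j : Fin m) (a : A), k i (k j a) = k j (k i a)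
  ke : ∀ (i j : Fin m) (a : A), k i (e j ((k i).symm a)) = q ^ cartan m i j • e j a
  kf : ∀ (i j : Fin m) (a : A), k i (f j ((k i).symm a)) = q ^ (-cartan m i j) • f j a
  ef : ∀ (i j : Fin m) (a : A),
      e i (f j a) - f j (e i a) =
        if i = j then (q - q⁻¹)⁻¹ • (k i a - (k i).symm a) else 0
  ee_comm : ∀ i j : Fin m, cartan m i j = 0 → ∀ a : A, e i (e j a) = e j (e i a)
  ff_comm : ∀ i j : Fin m, cartan m i j = 0 → ∀ a : A, f i (f j a) = f j (f i a)
  serre_e : ∀ i j : Fin m, cartan m i j = -1 → ∀ a : A,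
      e i (e i (e j a)) - (q + q⁻¹) • e i (e j (e i a)) + e j (e i (e i a)) = 0
  serre_f : ∀ i j : Fin m, cartan m i j = -1 → ∀ a : A,
      f i (f i (f j a)) - (q + q⁻¹) • f i (f j (f i a)) + f j (f i (f i a)) = 0

/-- Isomorphism of module-algebra structures: an algebra automorphism `ψ` of `A` with
`ψ ∘ π₁(h) ∘ ψ⁻¹ = π₂(h)` for every generator `h ∈ {k_i^{±1}, e_i, f_i}`. -/
def UqslMA.Iso {q : ℂ} {m : ℕ} {A : Type} [Ring A] [Algebra ℂ A]
    (π₁ π₂ : UqslMA q m A) : Prop :=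
  ∃ ψ : A ≃ₐ[ℂ] A,
    (∀ (i : Fin m) (a : A), ψ (π₁.k i (ψ.symm a)) = π₂.k i a) ∧
    (∀ (i : Fin m) (a : A), ψ ((π₁.k i).symm (ψ.symm a)) = (π₂.k i).symm a) ∧
    (∀ (i : Fin m) (a : A), ψ (π₁.e i (ψ.symm a)) = π₂.e i a) ∧
    (∀ (i : Fin m) (a : A), ψ (π₁.f i (ψ.symm a)) = π₂.f i a)

/-- The generator `x_1` of the quantum 3-space. -/
def Z1 (q : ℂ) : QSpace q 3 := Xg q 3 0
/-- The generator `x_2` of the quantum 3-space. -/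
def Z2 (q : ℂ) : QSpace q 3 := Xg q 3 1
/-- The generator `x_3` of the quantum 3-space. -/
def Z3 (q : ℂ) : QSpace q 3 := Xg q 3 2

/-- A diagonal sign `U_q(sl(3))`-action with sign data `ε` on the quantum 3-space:
`k_i(x_s) = ε_{i,s} x_s` and `e_i(x_s) = f_i(x_s) = 0`. -/
def DiagDesc (q : ℂ) (π : UqslMA q 2 (QSpace q 3)) (ε : Fin 2 → Fin 3 → ℂ) : Prop :=
  (∀ (i : Fin 2) (s : Fin 3), π.k i (Xg q 3 s) = ε i s • Xg q 3 s) ∧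
  (∀ (i : Fin 2) (s : Fin 3), π.e i (Xg q 3 s) = 0) ∧
  (∀ (i : Fin 2) (s : Fin 3), π.f i (Xg q 3 s) = 0)

namespace QSpace

open Polynomial

variable {q : ℂ} {n : ℕ}

/-- The relation `x_i x_j = q x_j x_i` for `i > j`. -/
lemma Xg_mul_Xg {i j : Fin n} (h : j < i) :
    Xg q n i * Xg q n j = q • (Xg q n j * Xg q n i) := by
  have := RingQuot.mkAlgHom_rel ℂ (QRel.rel (q := q) i j h)
  rw [map_mul, map_smul, map_mul] at this
  exact this

/-- The universal property of the quantum space. -/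
def lift {B : Type*} [Semiring B] [Algebra ℂ B] (g : Fin n → B)
    (h : ∀ i j, j < i → g i * g j = q • (g j * g i)) : QSpace q n →ₐ[ℂ] B :=
  RingQuot.liftAlgHom ℂ ⟨FreeAlgebra.lift ℂ g, by
    rintro _ _ ⟨i, j, hij⟩
    simpa using h i j hij⟩

@[simp]
lemma lift_Xg {B : Type*} [Semiring B] [Algebra ℂ B] (g : Fin n → B)
    (h : ∀ i j, j < i → g i * g j = q • (g j * g i)) (i : Fin n) :
    lift g h (Xg q n i) = g i := by
  simp [lift, Xg]

lemma algHom_ext {B : Type*} [Semiring B] [Algebra ℂ B] {φ χ : QSpace q n →ₐ[ℂ] B}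
    (h : ∀ i, φ (Xg q n i) = χ (Xg q n i)) : φ = χ := by
  apply RingQuot.ringQuot_ext'
  apply FreeAlgebra.hom_ext
  funext i
  exact h i

lemma induction {p : QSpace q n → Prop} (hc : ∀ c : ℂ, p (algebraMap ℂ _ c))
    (hX : ∀ i, p (Xg q n i)) (hadd : ∀ a b, p a → p b → p (a + b))
    (hmul : ∀ a b, p a → p b → p (a * b)) (a : QSpace q n) : p a := by
  obtain ⟨a, rfl⟩ := RingQuot.mkAlgHom_surjective ℂ (QRel q n) a
  induction a using FreeAlgebra.induction with
  | grade0 r => simpa only [AlgHom.commutes] using hc r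
  | grade1 i => exact hX i
  | mul a b ha hb => simpa only [map_mul] using hmul _ _ ha hb
  | add a b ha hb => simpa only [map_add] using hadd _ _ ha hb

/-- Restriction to the `a`-th coordinate axis: `x_a ↦ X` and `x_s ↦ 0` for `s ≠ a`. -/
def axis (q : ℂ) (a : Fin n) : QSpace q n →ₐ[ℂ] ℂ[X] :=
  lift (fun s => if s = a then X else 0) fun i j hij => by
    by_cases hi : i = a
    · simp [show j ≠ a by rintro rfl; exact hij.ne' hi]
    · simp [hi]

@[simp]
lemma axis_Xg (a s : Fin n) : axis q a (Xg q n s) = if s = a then X else 0 := by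
  simp [axis]

lemma axis_coeff_zero (a b : Fin n) (y : QSpace q n) :
    (axis q a y).coeff 0 = (axis q b y).coeff 0 := by
  have : (aeval (0 : ℂ)).comp (axis q a) = (aeval (0 : ℂ)).comp (axis q b) := by
    apply algHom_ext
    intro s
    by_cases h : s = a <;> by_cases h' : s = b <;> simp [h, h'] <;> simp_all
  have := DFunLike.congr_fun this y
  simpa [coeff_zero_eq_eval_zero] using this

/-- A three-dimensional representation detecting the coefficient of `x_a x_b` for `a < b`. -/
def triangular (q : ℂ) {a b : Fin n} (hab : a < b) :
    QSpace q n →ₐ[ℂ] Matrix (Fin 3) (Fin 3) ℂ :=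
  lift (fun s => if s = a then !![0, 1, 0; 0, 0, q; 0, 0, 0]
      else if s = b then !![0, 1, 0; 0, 0, 1; 0, 0, 0] else 0) fun i j hij => by
    by_cases hia : i = a
    · have h1 : j ≠ a := by omega
      have h2 : j ≠ b := by omega
      simp [h1, h2]
    by_cases hib : i = b
    · by_cases hja : j = a
      · simp [hib, hja, hab.ne']
      · have h2 : j ≠ b := by omega
        simp [hja, h2]
    · simp [hia, hib]

lemma triangular_apply {a b : Fin n} (hab : a < b) (y : QSpace q n) :
    ∃ t : ℂ, triangular q hab y =
      !![(axis q a y).coeff 0, (axis q a y).coeff 1 + (axis q b y).coeff 1, t;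
        0, (axis q a y).coeff 0, q * (axis q a y).coeff 1 + (axis q b y).coeff 1;
        0, 0, (axis q a y).coeff 0] := by
  induction y using QSpace.induction with
  | hc c =>
    refine ⟨0, ?_⟩
    ext i j
    fin_cases i <;> fin_cases j <;> simp [Matrix.algebraMap_matrix_apply, coeff_C]
  | hX s =>
    refine ⟨0, ?_⟩
    by_cases ha : s = a
    · simp [triangular, ha, hab.ne]
    · by_cases hb : s = b
      · simp [triangular, hb, hab.ne']
      · simp only [triangular, lift_Xg, ha, hb, axis_Xg, if_false]
        ext i j
        fin_cases i <;> fin_cases j <;> simp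
  | hadd y z hy hz =>
    obtain ⟨t, ht⟩ := hy
    obtain ⟨u, hu⟩ := hz
    refine ⟨t + u, ?_⟩
    rw [map_add, ht, hu]
    ext i j
    fin_cases i <;> fin_cases j <;> simp <;> ring
  | hmul y z hy hz =>
    obtain ⟨t, ht⟩ := hy
    obtain ⟨u, hu⟩ := hz
    refine ⟨(axis q a y).coeff 0 * u + ((axis q a y).coeff 1 + (axis q b y).coeff 1) *
      (q * (axis q a z).coeff 1 + (axis q b z).coeff 1) + t * (axis q a z).coeff 0, ?_⟩
    rw [map_mul, ht, hu]
    ext i j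
    fin_cases i <;> fin_cases j <;>
      simp [Matrix.mul_apply, Fin.sum_univ_three, mul_coeff_zero, mul_coeff_one,
        axis_coeff_zero b a]
    all_goals ring

/-- Each coordinate axis is mapped by an automorphism into a coordinate axis. -/
lemma exists_axis_comp (h1 : q ≠ 1) [NeZero n] (ψ : QSpace q n →ₐ[ℂ] QSpace q n) (a : Fin n) :
    ∃ i, ∀ y, axis q a (ψ y) = (axis q i y).comp (axis q a (ψ (Xg q n i))) := by
  have key : ∃ i, ∀ j, j ≠ i → axis q a (ψ (Xg q n j)) = 0 := by
    by_cases h : ∃ i, axis q a (ψ (Xg q n i)) ≠ 0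
    · obtain ⟨i, hi⟩ := h
      refine ⟨i, fun j hj => ?_⟩
      have hmul : ∀ s t : Fin n, t < s →
          axis q a (ψ (Xg q n s)) * axis q a (ψ (Xg q n t)) = 0 := by
        intro s t hts
        have h := congrArg (fun y => axis q a (ψ y)) (Xg_mul_Xg (q := q) hts)
        simp only [map_mul, map_smul] at h
        rw [mul_comm (axis q a (ψ (Xg q n t)))] at h
        have h' : (1 - q) • (axis q a (ψ (Xg q n s)) * axis q a (ψ (Xg q n t))) = 0 := by
          rw [sub_smul, one_smul, ← h, sub_self]
        exact (smul_eq_zero.mp h').resolve_left (sub_ne_zero.mpr h1.symm)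
      rcases lt_or_gt_of_ne hj with h | h
      · exact (mul_eq_zero.mp (hmul i j h)).resolve_left hi
      · exact (mul_eq_zero.mp (hmul j i h)).resolve_right hi
    · push Not at h
      exact ⟨0, fun j _ => h j⟩
  obtain ⟨i, hi⟩ := key
  refine ⟨i, fun y => ?_⟩
  have : (axis q a).comp ψ = (aeval (axis q a (ψ (Xg q n i)))).comp (axis q i) := by
    apply algHom_ext
    intro s
    by_cases hs : s = i
    · simp [hs]
    · simp [hs, hi s hs]
  exact DFunLike.congr_fun this y

/-- The linear part of an automorphism is diagonal with non-zero diagonal entries. -/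
lemma axis_coeff_one_ne_zero (h1 : q ≠ 1) (h2 : q ^ 2 ≠ 1)
    (ψ : QSpace q 3 ≃ₐ[ℂ] QSpace q 3) (s : Fin 3) :
    (axis q s (ψ (Xg q 3 s))).coeff 1 ≠ 0 := by
  choose τ hτ using fun a => exists_axis_comp h1 (ψ : QSpace q 3 →ₐ[ℂ] QSpace q 3) a
  simp only [AlgEquiv.coe_toAlgHom] at hτ
  have hX : ∀ a, (axis q (τ a) (ψ.symm (Xg q 3 a))).comp (axis q a (ψ (Xg q 3 (τ a)))) = X := by
    intro a
    simpa using (hτ a (ψ.symm (Xg q 3 a))).symm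
  have hdeg : ∀ a, (axis q a (ψ (Xg q 3 (τ a)))).natDegree = 1 := by
    intro a
    have h := congrArg natDegree (hX a)
    rw [natDegree_comp, natDegree_X] at h
    exact Nat.eq_one_of_mul_eq_one_left h
  have hlin : ∀ a, (axis q a (ψ (Xg q 3 (τ a)))).coeff 1 ≠ 0 := by
    intro a h
    have h' := leadingCoeff_eq_zero.mp ((congrArg _ (hdeg a)).trans h)
    have h1 := hdeg a
    rw [h', natDegree_zero] at h1
    exact zero_ne_one h1
  have hinj : Function.Injective τ := by
    intro a b hab
    by_contra hne
    have h := hτ b (ψ.symm (Xg q 3 a))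
    rw [AlgEquiv.apply_symm_apply, axis_Xg, if_neg hne, ← hab] at h
    rcases comp_eq_zero_iff.mp h.symm with h | ⟨-, h⟩
    · have := hX a
      rw [h, zero_comp] at this
      exact X_ne_zero this.symm
    · have hd := hdeg b
      rw [← hab, h, natDegree_C] at hd
      exact zero_ne_one hd
  have hoff : ∀ a i, i ≠ τ a → axis q a (ψ (Xg q 3 i)) = 0 := by
    intro a i hi
    rw [hτ a, axis_Xg, if_neg hi, zero_comp]
  have hconst : ∀ a i, (axis q a (ψ (Xg q 3 i))).coeff 0 = 0 := by
    intro a i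
    obtain ⟨b, hb⟩ : ∃ b, i ≠ τ b := by
      by_contra! h
      exact zero_ne_one (hinj ((h 0).symm.trans (h 1)))
    rw [axis_coeff_zero a b, hoff b i hb, coeff_zero]
  have hmono : ∀ a b, a < b → τ a < τ b := by
    intro a b hab
    by_contra hlt
    have hne : τ a ≠ τ b := fun h => hab.ne (hinj h)
    have hlt : τ b < τ a := lt_of_le_of_ne (not_lt.mp hlt) hne.symm
    have h := congrArg (fun y => triangular q hab (ψ y)) (Xg_mul_Xg (q := q) hlt)
    obtain ⟨t, ht⟩ := triangular_apply hab (ψ (Xg q 3 (τ a)))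
    obtain ⟨u, hu⟩ := triangular_apply hab (ψ (Xg q 3 (τ b)))
    rw [hoff b _ hne, hconst] at ht
    rw [hoff a _ hne.symm] at hu
    simp only [map_mul, map_smul, ht, hu] at h
    have h := congrFun (congrFun h 0) 2
    simp [Matrix.mul_apply, Fin.sum_univ_three] at h
    have hpos := mul_ne_zero (hlin a) (hlin b)
    apply h2
    apply mul_right_cancel₀ hpos
    linear_combination -h
  have hs : τ s = s := by
    have h01 := hmono 0 1 (by decide)
    have h12 := hmono 1 2 (by decide)
    fin_cases s <;> simp <;> omega
  simpa only [hs] using hlin s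

/-- A diagonal automorphism acts on the linear part by its diagonal entries. -/
lemma axis_coeff_one_map {κ : QSpace q n →ₐ[ℂ] QSpace q n} {c : Fin n → ℂ}
    (hκ : ∀ s, κ (Xg q n s) = c s • Xg q n s) (s : Fin n) (y : QSpace q n) :
    (axis q s (κ y)).coeff 1 = c s * (axis q s y).coeff 1 := by
  have : (axis q s).comp κ = (aeval (C (c s) * X)).comp (axis q s) := by
    apply algHom_ext
    intro t
    by_cases h : t = s <;> simp [hκ, h, smul_eq_C_mul]
  have : axis q s (κ y) = (axis q s y).comp (C (c s) * X) := DFunLike.congr_fun this y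
  rw [this, comp_C_mul_X_coeff, pow_one, mul_comm]

/-- The diagonal endomorphism rescaling the generators. -/
def scale (q : ℂ) (c : Fin n → ℂ) : QSpace q n →ₐ[ℂ] QSpace q n :=
  lift (fun s => c s • Xg q n s) fun i j hij => by
    simp only [smul_mul_smul_comm, Xg_mul_Xg hij, smul_smul]
    congr 1
    ring

@[simp]
lemma scale_Xg (c : Fin n → ℂ) (s : Fin n) : scale q c (Xg q n s) = c s • Xg q n s := by
  simp [scale]

lemma scale_comp_scale {c d : Fin n → ℂ} (h : ∀ s, c s * d s = 1) :
    (scale q c).comp (scale q d) = AlgHom.id ℂ _ := by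
  apply algHom_ext
  intro s
  simp [smul_smul, mul_comm (d s), h]

lemma scale_comm (c d : Fin n → ℂ) (y : QSpace q n) :
    scale q c (scale q d y) = scale q d (scale q c y) := by
  have : (scale q c).comp (scale q d) = (scale q d).comp (scale q c) := by
    apply algHom_ext
    intro s
    simp [smul_smul, mul_comm (d s)]
  exact DFunLike.congr_fun this y

/-- The diagonal involution given by signs. -/
def signEquiv (q : ℂ) (c : Fin n → ℂ) (h : ∀ s, c s * c s = 1) : QSpace q n ≃ₐ[ℂ] QSpace q n :=
  AlgEquiv.ofAlgHom (scale q c) (scale q c) (scale_comp_scale h) (scale_comp_scale h)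

end QSpace

namespace UqslMA

variable {q : ℂ} {m n : ℕ}

/-- The structure in which every `k_i` is a diagonal involution and `e_i = f_i = 0`. -/
def ofSigns (q : ℂ) (ε : Fin m → Fin n → ℂ) (h : ∀ i s, ε i s * ε i s = 1) :
    UqslMA q m (QSpace q n) where
  k i := QSpace.signEquiv q (ε i) (h i)
  e _ := 0
  f _ := 0
  e_mul := by simp
  f_mul := by simp
  e_one := by simp
  f_one := by simp
  k_comm i j a := QSpace.scale_comm _ _ a
  ke := by simp
  kf := by simp
  ef i j a := by simp [QSpace.signEquiv]
  ee_comm := by simp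
  ff_comm := by simp
  serre_e := by simp
  serre_f := by simp

lemma e_eq_zero (π : UqslMA q m (QSpace q n)) (i : Fin m) (h : ∀ s, π.e i (Xg q n s) = 0)
    (y : QSpace q n) : π.e i y = 0 := by
  induction y using QSpace.induction with
  | hc c => rw [Algebra.algebraMap_eq_smul_one, map_smul, π.e_one, smul_zero]
  | hX s => exact h s
  | hadd a b ha hb => rw [map_add, ha, hb, add_zero]
  | hmul a b ha hb => rw [π.e_mul, ha, hb, mul_zero, zero_mul, add_zero]

lemma f_eq_zero (π : UqslMA q m (QSpace q n)) (i : Fin m) (h : ∀ s, π.f i (Xg q n s) = 0)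
    (y : QSpace q n) : π.f i y = 0 := by
  induction y using QSpace.induction with
  | hc c => rw [Algebra.algebraMap_eq_smul_one, map_smul, π.f_one, smul_zero]
  | hX s => exact h s
  | hadd a b ha hb => rw [map_add, ha, hb, add_zero]
  | hmul a b ha hb => rw [π.f_mul, ha, hb, mul_zero, zero_mul, add_zero]

end UqslMA

/-- Each choice of signs `ε_{i,s} ∈ {1, −1}` gives a `U_q(sl(3))`-module-algebra structure
on `A_q(3)`, and two such structures are isomorphic iff the sign data agree. -/
theorem Uqsl3_on_Aq3_diag (q : ℂ) (hq : q ≠ 0)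
    (hq' : ∀ N : ℕ, 0 < N → q ^ N ≠ 1) :
    (∀ ε : Fin 2 → Fin 3 → ℂ, (∀ i s, ε i s = 1 ∨ ε i s = -1) →
      ∃ π : UqslMA q 2 (QSpace q 3), DiagDesc q π ε) ∧
    (∀ ε ε' : Fin 2 → Fin 3 → ℂ,
      (∀ i s, ε i s = 1 ∨ ε i s = -1) → (∀ i s, ε' i s = 1 ∨ ε' i s = -1) →
      ∀ π π' : UqslMA q 2 (QSpace q 3),
        DiagDesc q π ε → DiagDesc q π' ε' → (π.Iso π' ↔ ε = ε')) := by
  refine ⟨fun ε hε => ?_, fun ε ε' _ _ π π' hπ hπ' => ⟨?_, ?_⟩⟩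
  · have hsq : ∀ i s, ε i s * ε i s = 1 := fun i s => by rcases hε i s with h | h <;> simp [h]
    exact ⟨UqslMA.ofSigns q ε hsq, fun i s => QSpace.scale_Xg _ s, fun _ _ => rfl, fun _ _ => rfl⟩
  · rintro ⟨ψ, hk, -⟩
    have h1 : q ≠ 1 := by simpa using hq' 1 one_pos
    funext i s
    have hne := QSpace.axis_coeff_one_ne_zero h1 (hq' 2 two_pos) ψ s
    have h := hk i (ψ (Xg q 3 s))
    rw [AlgEquiv.symm_apply_apply, hπ.1, map_smul] at h
    have h' := QSpace.axis_coeff_one_map (κ := (π'.k i : QSpace q 3 →ₐ[ℂ] QSpace q 3))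
      (hπ'.1 i) s (ψ (Xg q 3 s))
    rw [AlgEquiv.coe_toAlgHom, ← h, map_smul, Polynomial.coeff_smul, smul_eq_mul] at h'
    exact mul_right_cancel₀ hne h'
  · rintro rfl
    have hk : ∀ i, π.k i = π'.k i := by
      intro i
      have h : (π.k i : QSpace q 3 →ₐ[ℂ] QSpace q 3) = π'.k i :=
        QSpace.algHom_ext fun s => (hπ.1 i s).trans (hπ'.1 i s).symm
      exact AlgEquiv.ext fun y => DFunLike.congr_fun h y
    refine ⟨AlgEquiv.refl, fun i a => ?_, fun i a => ?_, fun i a => ?_, fun i a => ?_⟩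
    · simp [hk i]
    · simp [hk i]
    · simp [π.e_eq_zero i (hπ.2.1 i), π'.e_eq_zero i (hπ'.2.1 i)]
    · simp [π.f_eq_zero i (hπ.2.2 i), π'.f_eq_zero i (hπ'.2.2 i)]
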